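/- Let h ∈ F_q[x] satisfy gcd(h(x), (x^n − 1)/(x − 1)) = 1 in F_q[x]. Then for every α, θ_0, ..., θ_{q−1} ∈ F_{q^n} such that Tr_{q^n/q}(α) ≠ −h(1), the polynomial P(x) = L_h(x) + α·Tr_{q^n/q}(x) + Σ_{i=0}^{q−1} (θ_i^q − θ_i)·Tr_{q^n/q}(x)^i is a permutation polynomial of F_{q^n}. -/

import Mathlib

open Polynomial

/-- The linearized `q`-associate of `f ∈ 𝔽_q[x]`, evaluated on an extension field:
`L_f(y) = Σ aᵢ y^(qⁱ)` where `q` is the cardinality of `Fq`. -/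
noncomputable def Lq {Fq Fqn : Type*} [Field Fq] [Fintype Fq] [Field Fqn] [Algebra Fq Fqn]
    (f : Polynomial Fq) (y : Fqn) : Fqn :=
  f.sum fun i a => algebraMap Fq Fqn a * y ^ (Fintype.card Fq) ^ i

/-- `T_n[f](x) = Σ Tr(aᵢ) xⁱ ∈ 𝔽_q[x]` for `f = Σ aᵢ xⁱ ∈ 𝔽_{qⁿ}[x]`, where `Tr` is the
field trace from `𝔽_{qⁿ}` onto `𝔽_q`. -/
noncomputable def Tn (Fq : Type*) {Fqn : Type*} [Field Fq] [Field Fqn] [Algebra Fq Fqn]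
    (f : Polynomial Fqn) : Polynomial Fq :=
  f.sum fun i a => C (Algebra.trace Fq Fqn a) * X ^ i

theorem trace_mul_algebraMap {K L : Type*} [Field K] [Field L] [Algebra K L] (x : L) (c : K) :
    Algebra.trace K L (x * algebraMap K L c) = c * Algebra.trace K L x := by
  rw [mul_comm, ← Algebra.smul_def, map_smul, smul_eq_mul]

section LinearizedAssociate

variable {Fq Fqn : Type*} [Field Fq] [Fintype Fq] [Field Fqn] [Algebra Fq Fqn]

theorem Lq_eq_aeval_frobenius (f : Polynomial Fq) (y : Fqn) :
    Lq f y = aeval (FiniteField.frobeniusAlgHom Fq Fqn).toLinearMap f y := by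
  rw [Lq, aeval_eq_sum_range, Polynomial.sum_over_range _ (by simp), LinearMap.sum_apply]
  refine Finset.sum_congr rfl fun i _ => ?_
  have hpow : ((FiniteField.frobeniusAlgHom Fq Fqn).toLinearMap ^ i) y =
      y ^ Fintype.card Fq ^ i := by
    rw [Module.End.pow_apply, AlgHom.coe_toLinearMap, FiniteField.coe_frobeniusAlgHom,
      pow_iterate]
  rw [LinearMap.smul_apply, hpow, Algebra.smul_def]

theorem Lq_sub_apply (f : Polynomial Fq) (x y : Fqn) : Lq f (x - y) = Lq f x - Lq f y := by
  simp only [Lq_eq_aeval_frobenius, map_sub]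

theorem eq_zero_of_Lq_eq_zero_of_isCoprime {f g : Polynomial Fq} (hfg : IsCoprime f g) {y : Fqn}
    (hf : Lq f y = 0) (hg : Lq g y = 0) : y = 0 := by
  rw [Lq_eq_aeval_frobenius] at hf hg
  exact (Submodule.disjoint_def.mp (disjoint_ker_aeval_of_isCoprime _ hfg)) y hf hg

variable [FiniteDimensional Fq Fqn]

theorem trace_pow_card (x : Fqn) :
    Algebra.trace Fq Fqn (x ^ Fintype.card Fq) = Algebra.trace Fq Fqn x :=
  Algebra.trace_eq_of_algEquiv (FiniteField.frobeniusAlgEquivOfAlgebraic Fq Fqn) x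

theorem trace_pow_card_pow (x : Fqn) (i : ℕ) :
    Algebra.trace Fq Fqn (x ^ Fintype.card Fq ^ i) = Algebra.trace Fq Fqn x := by
  induction i with
  | zero => simp
  | succ i ih => rw [pow_succ, pow_mul, trace_pow_card, ih]

theorem trace_Lq (f : Polynomial Fq) (x : Fqn) :
    Algebra.trace Fq Fqn (Lq f x) = f.eval 1 * Algebra.trace Fq Fqn x := by
  rw [Lq, eval_eq_sum, Polynomial.sum, Polynomial.sum, map_sum, Finset.sum_mul]
  refine Finset.sum_congr rfl fun i _ => ?_
  rw [mul_comm, trace_mul_algebraMap, trace_pow_card_pow, one_pow, mul_one]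

theorem Lq_geom_sum (x : Fqn) :
    Lq (∑ i ∈ Finset.range (Module.finrank Fq Fqn), X ^ i : Polynomial Fq) x =
      algebraMap Fq Fqn (Algebra.trace Fq Fqn x) := by
  have : Finite Fqn := Module.finite_of_finite Fq
  rw [FiniteField.algebraMap_trace_eq_sum_pow, Lq_eq_aeval_frobenius, map_sum,
    LinearMap.sum_apply]
  refine Finset.sum_congr rfl fun i _ => ?_
  rw [map_pow, aeval_X, Module.End.pow_apply, AlgHom.coe_toLinearMap,
    FiniteField.coe_frobeniusAlgHom, pow_iterate, Nat.card_eq_fintype_card]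

end LinearizedAssociate

theorem X_pow_sub_one_div_X_sub_one {K : Type*} [Field K] (n : ℕ) :
    ((X ^ n - 1) / (X - 1) : Polynomial K) = ∑ i ∈ Finset.range n, X ^ i := by
  rw [← geom_sum_mul]
  exact mul_div_cancel_right₀ _ (by simpa using X_sub_C_ne_zero (1 : K))

/-- Let `h ∈ 𝔽_q[x]` with `gcd(h, (xⁿ-1)/(x-1)) = 1`. For any `α, θ₀, …, θ_{q-1} ∈ 𝔽_{qⁿ}`
with `Tr(α) ≠ -h(1)`, the polynomial
`P(x) = L_h(x) + α·Tr(x) + Σᵢ (θᵢ^q - θᵢ)·Tr(x)ⁱ` permutes `𝔽_{qⁿ}`. -/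
theorem PP_monomial_construction_deg_one {Fq Fqn : Type*} [Field Fq] [Fintype Fq]
    [DecidableEq Fq] [Field Fqn] [Algebra Fq Fqn]
    {n : ℕ} (hn : 0 < n) (hrank : Module.finrank Fq Fqn = n)
    (h : Polynomial Fq) (hgcd : gcd h ((X ^ n - 1) / (X - 1) : Polynomial Fq) = 1)
    (α : Fqn) (θ : Fin (Fintype.card Fq) → Fqn)
    (hα : Algebra.trace Fq Fqn α ≠ -(h.eval 1)) :
    Function.Bijective fun x : Fqn =>
      Lq h x + α * algebraMap Fq Fqn (Algebra.trace Fq Fqn x) +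
        ∑ i : Fin (Fintype.card Fq),
          (θ i ^ Fintype.card Fq - θ i) *
            algebraMap Fq Fqn (Algebra.trace Fq Fqn x) ^ (i : ℕ) := by
  subst hrank
  have : FiniteDimensional Fq Fqn := Module.finite_of_finrank_pos hn
  have : Finite Fqn := Module.finite_of_finite Fq
  rw [X_pow_sub_one_div_X_sub_one] at hgcd
  have hcop := (gcd_isUnit_iff _ _).mp (hgcd ▸ isUnit_one)
  have htrace (x : Fqn) : Algebra.trace Fq Fqn (Lq h x +
      α * algebraMap Fq Fqn (Algebra.trace Fq Fqn x) + ∑ i : Fin (Fintype.card Fq),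
        (θ i ^ Fintype.card Fq - θ i) * algebraMap Fq Fqn (Algebra.trace Fq Fqn x) ^ (i : ℕ)) =
      (Algebra.trace Fq Fqn α + h.eval 1) * Algebra.trace Fq Fqn x := by
    simp only [map_add, map_sum, ← map_pow (algebraMap Fq Fqn), trace_mul_algebraMap, map_sub,
      trace_pow_card, sub_self, mul_zero, Finset.sum_const_zero, trace_Lq]
    ring
  refine Finite.injective_iff_bijective.mp fun x y hxy => ?_
  have htr : Algebra.trace Fq Fqn x = Algebra.trace Fq Fqn y := by
    have hxy' := congrArg (Algebra.trace Fq Fqn) hxy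
    simp only [htrace] at hxy'
    exact mul_left_cancel₀ (fun h0 => hα (eq_neg_of_add_eq_zero_left h0)) hxy'
  simp only [htr, add_left_inj] at hxy
  refine sub_eq_zero.mp (eq_zero_of_Lq_eq_zero_of_isCoprime hcop ?_ ?_)
  · rw [Lq_sub_apply, hxy, sub_self]
  · rw [Lq_geom_sum, map_sub, htr, sub_self, map_zero]
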